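/- arXiv:1809.00422 — 2 statements merged into one kernel-verified Lean document; each statement's English description precedes it below -/
import Mathlib

section
/- (Monod) Let H(ℝ) be the group (under composition) of increasing homeomorphisms h of ℝ for which there exist finitely many points x₁ < x₂ < ... < x_k in ℝ such that on each of the intervals (−∞, x₁), (x₁, x₂), ..., (x_{k−1}, x_k), (x_k, ∞), h agrees with a fractional linear transformation t ↦ (a·t + b)/(c·t + d) for some matrix [[a, b], [c, d]] ∈ SL₂(ℝ). Then H(ℝ) does not contain a nonabelian free subgroup: there is no injective group homomorphism from the free group on two generators into H(ℝ). -/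
/-- h agrees on the set s with the fractional linear transformation coming from a matrix in
SL₂(ℝ). -/
def IsFracLinOn (h : ℝ → ℝ) (s : Set ℝ) : Prop :=
  ∃ g : Matrix.SpecialLinearGroup (Fin 2) ℝ, ∀ t ∈ s,
    h t = (g.1 0 0 * t + g.1 0 1) / (g.1 1 0 * t + g.1 1 1)

/-- h is piecewise PSL₂(ℝ): there are finitely many points x₀ < x₁ < ⋯ < x_k such that on
each of the intervals (−∞, x₀), (x₀, x₁), …, (x_{k−1}, x_k), (x_k, ∞), h agrees with a
fractional linear transformation coming from SL₂(ℝ). -/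
def PiecewisePSL (h : ℝ → ℝ) : Prop :=
  ∃ (k : ℕ) (x : Fin (k + 1) → ℝ), StrictMono x ∧
    IsFracLinOn h (Set.Iio (x 0)) ∧
    IsFracLinOn h (Set.Ioi (x (Fin.last k))) ∧
    ∀ i : Fin k, IsFracLinOn h (Set.Ioo (x i.castSucc) (x i.succ))

/-- Membership in Monod's group H(ℝ) of increasing piecewise-PSL₂(ℝ) homeomorphisms of ℝ. -/
def MemH (f : Equiv.Perm ℝ) : Prop :=
  StrictMono f ∧ PiecewisePSL f

open Filter Topology Set Bornology
open scoped commutatorElement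

section FreeGroups

/-- Commuting elements of a free group are commensurable: they have a common power. -/
theorem IsFreeGroup.exists_zpow_eq_zpow_of_commute {F : Type*} [Group F] [IsFreeGroup F]
    {a b : F} (hab : Commute a b) (hb : b ≠ 1) : ∃ m n : ℤ, m ≠ 0 ∧ a ^ m = b ^ n := by
  set K : Subgroup F := Subgroup.closure {a, b}
  have ha' : a ∈ K := Subgroup.subset_closure (by simp)
  have hb' : b ∈ K := Subgroup.subset_closure (by simp)
  have hcomm : ∀ x y : K, x * y = y * x := by
    have : IsMulCommutative K := Subgroup.isMulCommutative_closure (by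
      rintro x (rfl | rfl) y (rfl | rfl)
      exacts [rfl, hab, hab.symm, rfl])
    exact fun x y => this.is_comm.comm x y
  let B := IsFreeGroup.basis K
  have hsub : Subsingleton (IsFreeGroup.Generators K) := by
    classical
    refine ⟨fun i j => by_contra fun hij => ?_⟩
    let f : K →* Equiv.Perm (Fin 3) :=
      B.lift (fun k => if k = i then Equiv.swap 0 1 else Equiv.swap 1 2)
    have h := congrArg f (hcomm (B i) (B j))
    have hf : ∀ k, f (B k) = if k = i then Equiv.swap 0 1 else Equiv.swap 1 2 :=
      congrFun (B.lift.symm_apply_apply _)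
    rw [map_mul, map_mul, hf, hf, if_pos rfl, if_neg (Ne.symm hij)] at h
    revert h
    decide
  have hcyc : ∃ c : K, ∀ x : K, ∃ n : ℤ, c ^ n = x := by
    have hb1 : (⟨b, hb'⟩ : K) ≠ 1 := fun h => hb (congrArg Subtype.val h)
    obtain ⟨i⟩ : Nonempty (IsFreeGroup.Generators K) := by
      by_contra hne
      rw [not_nonempty_iff] at hne
      exact hb1 (B.repr.injective (Subsingleton.elim _ _))
    refine ⟨B.repr.symm (FreeGroup.of i), fun x => ?_⟩
    have hx : B.repr x ∈ Subgroup.zpowers (FreeGroup.of i) := by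
      have htop := FreeGroup.closure_range_of (IsFreeGroup.Generators K)
      have hr : range (FreeGroup.of (α := IsFreeGroup.Generators K)) = {FreeGroup.of i} := by
        ext z
        simp only [mem_range, mem_singleton_iff]
        exact ⟨fun ⟨j, hj⟩ => by rw [← hj, hsub.elim j i], fun h => ⟨i, h.symm⟩⟩
      rw [hr, ← Subgroup.zpowers_eq_closure] at htop
      rw [htop]
      trivial
    obtain ⟨n, hn⟩ := hx
    refine ⟨n, B.repr.injective ?_⟩
    simpa using hn
  obtain ⟨c, hc⟩ := hcyc
  obtain ⟨n, hn⟩ := hc ⟨a, ha'⟩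
  obtain ⟨m, hm⟩ := hc ⟨b, hb'⟩
  have hn' : (c : F) ^ n = a := by simpa using congrArg Subtype.val hn
  have hm' : (c : F) ^ m = b := by simpa using congrArg Subtype.val hm
  refine ⟨m, n, ?_, ?_⟩
  · rintro rfl
    exact hb (by simpa using hm'.symm)
  · rw [← hn', ← hm', ← zpow_mul, ← zpow_mul, mul_comm]

/-- The free group on two generators is not metabelian. -/
theorem FreeGroup.derivedSeries_two_ne_bot : derivedSeries (FreeGroup Bool) 2 ≠ ⊥ := by
  intro h
  let x : FreeGroup Bool := FreeGroup.of true
  let y : FreeGroup Bool := FreeGroup.of false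
  have hmem : ⁅⁅x, y⁆, ⁅x⁻¹, y⁆⁆ ∈ derivedSeries (FreeGroup Bool) 2 :=
    Subgroup.commutator_mem_commutator
      (Subgroup.commutator_mem_commutator trivial trivial)
      (Subgroup.commutator_mem_commutator trivial trivial)
  rw [h, Subgroup.mem_bot] at hmem
  revert hmem
  decide

end FreeGroups

section AffineGerms

variable {G X : Type*} [Group G]

/-- The elements acting near `L` as translations by elements of `A` in the coordinate `c`. -/
def translationGerms (φ : G →* Equiv.Perm X) (L : Filter X) (c : X → ℝ) (A : AddSubgroup ℝ)
    (hL : ∀ g, Tendsto (φ g) L L) : Subgroup G where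
  carrier := {g | ∃ q ∈ A, ∀ᶠ t in L, c (φ g t) = c t + q}
  one_mem' := ⟨0, A.zero_mem, by simp⟩
  mul_mem' := by
    rintro a b ⟨p, hpA, hp⟩ ⟨q, hqA, hq⟩
    refine ⟨q + p, A.add_mem hqA hpA, ?_⟩
    filter_upwards [hq, (hL b).eventually hp] with t h1 h2
    rw [map_mul, Equiv.Perm.mul_apply, h2, h1, add_assoc]
  inv_mem' := by
    rintro a ⟨p, hpA, hp⟩
    refine ⟨-p, A.neg_mem hpA, ?_⟩
    filter_upwards [(hL a⁻¹).eventually hp] with t h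
    rw [← Equiv.Perm.mul_apply, ← map_mul, mul_inv_cancel, map_one, Equiv.Perm.one_apply] at h
    rw [h, add_neg_cancel_right]

theorem commutator_mem_translationGerms {φ : G →* Equiv.Perm X} {L : Filter X} {c : X → ℝ}
    {A : AddSubgroup ℝ} {hL : ∀ g, Tendsto (φ g) L L} {a b : G} {q : ℝ} (hq : q ∈ A)
    (h : ∀ᶠ t in L, c (φ (a * b) t) = c (φ (b * a) t) + q) :
    ⁅a, b⁆ ∈ translationGerms φ L c A hL := by
  refine ⟨q, hq, ?_⟩
  filter_upwards [(hL (b * a)⁻¹).eventually h] with t ht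
  rw [← Equiv.Perm.mul_apply, ← Equiv.Perm.mul_apply, ← map_mul, ← map_mul, mul_inv_cancel,
    map_one, mul_inv_rev, ← mul_assoc, ← commutatorElement_def] at ht
  exact ht

/-- If a group acts by affine germs near `L`, its second derived subgroup has trivial germs. -/
theorem eventually_fixed_of_mem_derivedSeries_two {φ : G →* Equiv.Perm X} {L : Filter X}
    {c : X → ℝ} (hc : Function.Injective c) (hL : ∀ g, Tendsto (φ g) L L)
    (haff : ∀ g, ∃ p q : ℝ, ∀ᶠ t in L, c (φ g t) = p * c t + q) {w : G}
    (hw : w ∈ derivedSeries G 2) : ∀ᶠ t in L, φ w t = t := by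
  have h1 : derivedSeries G 1 ≤ translationGerms φ L c ⊤ hL := by
    refine Subgroup.commutator_le.mpr fun a _ b _ => ?_
    obtain ⟨p, q, hpq⟩ := haff a
    obtain ⟨r, s, hrs⟩ := haff b
    refine commutator_mem_translationGerms (q := (p * s + q) - (r * q + s)) trivial ?_
    filter_upwards [hpq, hrs, (hL b).eventually hpq, (hL a).eventually hrs] with t h1 h2 h3 h4
    rw [map_mul, map_mul, Equiv.Perm.mul_apply, Equiv.Perm.mul_apply, h3, h4, h1, h2]
    ring
  have h2 : derivedSeries G 2 ≤ translationGerms φ L c ⊥ hL := by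
    refine Subgroup.commutator_le.mpr fun a ha b hb => ?_
    obtain ⟨p, -, hp⟩ := h1 ha
    obtain ⟨q, -, hq⟩ := h1 hb
    refine commutator_mem_translationGerms (q := 0) (zero_mem _) ?_
    filter_upwards [hp, hq, (hL b).eventually hp, (hL a).eventually hq] with t h1 h2 h3 h4
    rw [map_mul, map_mul, Equiv.Perm.mul_apply, Equiv.Perm.mul_apply, h3, h4, h1, h2]
    ring
  obtain ⟨q, hq0, hq⟩ := h2 hw
  rw [AddSubgroup.mem_bot] at hq0
  filter_upwards [hq] with t ht
  exact hc (by rw [ht, hq0, add_zero])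

end AffineGerms

section Germs

variable {h : ℝ → ℝ}

theorem PiecewisePSL.isFracLinOn_right (hh : PiecewisePSL h) (y : ℝ) :
    ∃ s ∈ 𝓝[>] y, IsFracLinOn h s := by
  obtain ⟨k, x, -, h0, hlast, hmid⟩ := hh
  rcases lt_or_ge y (x 0) with hy | hy
  · exact ⟨_, mem_nhdsWithin_of_mem_nhds (Iio_mem_nhds hy), h0⟩
  by_cases hex : ∃ i : Fin k, x i.castSucc ≤ y ∧ y < x i.succ
  · obtain ⟨i, hi, hi'⟩ := hex
    exact ⟨_, mem_of_superset (Ioo_mem_nhdsGT hi') (Ioo_subset_Ioo_left hi), hmid i⟩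
  · push Not at hex
    have hall : ∀ i, x i ≤ y := fun i => Fin.induction hy (fun i hi => hex i hi) i
    exact ⟨_, mem_of_superset self_mem_nhdsWithin (Ioi_subset_Ioi (hall _)), hlast⟩

theorem PiecewisePSL.isFracLinOn_left (hh : PiecewisePSL h) (y : ℝ) :
    ∃ s ∈ 𝓝[<] y, IsFracLinOn h s := by
  obtain ⟨k, x, -, h0, hlast, hmid⟩ := hh
  rcases le_or_gt y (x 0) with hy | hy
  · exact ⟨_, mem_of_superset self_mem_nhdsWithin (Iio_subset_Iio hy), h0⟩
  by_cases hex : ∃ i : Fin k, x i.castSucc < y ∧ y ≤ x i.succ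
  · obtain ⟨i, hi, hi'⟩ := hex
    exact ⟨_, mem_of_superset (Ioo_mem_nhdsLT hi) (Ioo_subset_Ioo_right hi'), hmid i⟩
  · push Not at hex
    have hall : ∀ i, x i < y := fun i => Fin.induction hy (fun i hi => hex i hi) i
    exact ⟨_, mem_nhdsWithin_of_mem_nhds (Ioi_mem_nhds (hall _)), hlast⟩

/-- Near a fixed point `x`, a fractional linear germ is affine in the coordinate
`t ↦ (t - x)⁻¹`. -/
theorem IsFracLinOn.eventually_affine_inv {x : ℝ} {s : Set ℝ} (hs : IsFracLinOn h s)
    {L : Filter ℝ} [L.NeBot] (hL : L ≤ 𝓝[≠] x) (hsL : s ∈ L) (hh : Tendsto h L (𝓝 x)) :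
    ∃ p q : ℝ, ∀ᶠ t in L, (h t - x)⁻¹ = p * (t - x)⁻¹ + q := by
  obtain ⟨g, hg⟩ := hs
  have hdet := g.det_coe
  rw [Matrix.det_fin_two] at hdet
  generalize g.1 0 0 = a at *
  generalize g.1 0 1 = b at *
  generalize g.1 1 0 = c at *
  generalize g.1 1 1 = d at *
  have hid : Tendsto (fun t : ℝ => t) L (𝓝 x) := hL.trans nhdsWithin_le_nhds
  have hden : ∀ᶠ t in L, c * t + d ≠ 0 := by
    by_cases hc : c * x + d = 0
    · filter_upwards [hL self_mem_nhdsWithin] with t ht h0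
      have hc0 : c * (t - x) = 0 := by linear_combination h0 - hc
      rcases mul_eq_zero.mp hc0 with h1 | h1
      · rw [h1] at hc hdet
        have : d = 0 := by linarith
        rw [this] at hdet
        linarith
      · exact ht (sub_eq_zero.mp h1)
    · exact ((hid.const_mul c).add_const d).eventually_ne hc
  have heq : ∀ᶠ t in L, h t * (c * t + d) = a * t + b := by
    filter_upwards [hsL, hden] with t ht h0
    rw [hg t ht, div_mul_cancel₀ _ h0]
  have hfix : x * (c * x + d) = a * x + b :=
    tendsto_nhds_unique_of_eventuallyEq (hh.mul ((hid.const_mul c).add_const d))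
      ((hid.const_mul a).add_const b) heq
  refine ⟨(c * x + d) / (a - c * x), c / (a - c * x), ?_⟩
  filter_upwards [hden, heq, hL self_mem_nhdsWithin] with t h0 h1 h2
  have h2' : t - x ≠ 0 := sub_ne_zero.mpr h2
  have h3 : h t - x = (a - c * x) * (t - x) / (c * t + d) := by
    rw [eq_div_iff h0]
    linear_combination h1 - hfix
  rw [h3, inv_div]
  by_cases h4 : a - c * x = 0
  · simp [h4]
  · field_simp
    ring

/-- A fractional linear germ at infinity which fixes infinity is affine. -/
theorem IsFracLinOn.eventually_affine {s : Set ℝ} (hs : IsFracLinOn h s)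
    {L : Filter ℝ} [L.NeBot] (hL : L ≤ cobounded ℝ) (hsL : s ∈ L)
    (hh : Tendsto h L (cobounded ℝ)) :
    ∃ p q : ℝ, ∀ᶠ t in L, h t = p * t + q := by
  obtain ⟨g, hg⟩ := hs
  have hdet := g.det_coe
  rw [Matrix.det_fin_two] at hdet
  generalize g.1 0 0 = a at *
  generalize g.1 0 1 = b at *
  generalize g.1 1 0 = c at *
  generalize g.1 1 1 = d at *
  by_cases hc : c = 0
  · refine ⟨a / d, b / d, ?_⟩
    filter_upwards [hsL] with t ht
    rw [hg t ht, hc]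
    ring
  · exfalso
    have hinv : Tendsto (fun t : ℝ => t⁻¹) L (𝓝 0) := tendsto_inv₀_cobounded.mono_left hL
    have hne : ∀ᶠ t in L, t ≠ 0 := hL (eventually_ne_cobounded 0)
    have hlim : Tendsto (fun t => (a + b * t⁻¹) / (c + d * t⁻¹)) L
        (𝓝 ((a + b * 0) / (c + d * 0))) :=
      ((hinv.const_mul b).const_add a).div ((hinv.const_mul d).const_add c) (by simpa using hc)
    have hlim' : Tendsto h L (𝓝 ((a + b * 0) / (c + d * 0))) := by
      refine hlim.congr' ?_
      filter_upwards [hsL, hne] with t ht h0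
      rw [hg t ht, ← mul_div_mul_right (a + b * t⁻¹) _ h0]
      congr 1 <;> field_simp
    exact hlim'.not_tendsto (Metric.disjoint_nhds_cobounded _) hh

end Germs

section DisjointSupports

variable {G : Type*} [Group G] {φ : G →* Equiv.Perm ℝ}

/-- The open convex hull of the orbit of `y`. -/
def orbitHull (φ : G →* Equiv.Perm ℝ) (y : ℝ) : Set ℝ :=
  {x | ∃ u v, φ u y < x ∧ x < φ v y}

theorem isOpen_orbitHull (y : ℝ) : IsOpen (orbitHull φ y) := by
  have : orbitHull φ y = ⋃ u, ⋃ v, Ioo (φ u y) (φ v y) := by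
    ext x
    simp [orbitHull]
  rw [this]
  exact isOpen_iUnion fun u => isOpen_iUnion fun v => isOpen_Ioo

theorem orbitHull_subset {x y : ℝ} (h : x ∈ orbitHull φ y) (hmono : ∀ g, StrictMono (φ g)) :
    orbitHull φ x ⊆ orbitHull φ y := by
  obtain ⟨u, v, hu, hv⟩ := h
  rintro z ⟨u', v', hu', hv'⟩
  refine ⟨u' * u, v' * v, ?_, ?_⟩
  · rw [map_mul, Equiv.Perm.mul_apply]
    exact (hmono u' hu).trans hu'
  · rw [map_mul, Equiv.Perm.mul_apply]
    exact hv'.trans (hmono v' hv)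

theorem mem_orbitHull_symm {x y : ℝ} (h : x ∈ orbitHull φ y) (hmono : ∀ g, StrictMono (φ g)) :
    y ∈ orbitHull φ x := by
  obtain ⟨u, v, hu, hv⟩ := h
  refine ⟨v⁻¹, u⁻¹, ?_, ?_⟩
  · simpa using hmono v⁻¹ hv
  · simpa using hmono u⁻¹ hu

theorem orbitHull_eq {x y : ℝ} (h : x ∈ orbitHull φ y) (hmono : ∀ g, StrictMono (φ g)) :
    orbitHull φ x = orbitHull φ y :=
  (orbitHull_subset h hmono).antisymm (orbitHull_subset (mem_orbitHull_symm h hmono) hmono)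

theorem apply_mem_orbitHull {x y : ℝ} (g : G) (h : x ∈ orbitHull φ y)
    (hmono : ∀ g, StrictMono (φ g)) : φ g x ∈ orbitHull φ y := by
  obtain ⟨u, v, hu, hv⟩ := h
  exact ⟨g * u, g * v, by simpa using hmono g hu, by simpa using hmono g hv⟩

theorem self_mem_orbitHull {g : G} {y : ℝ} (h : φ g y ≠ y) (hmono : ∀ g, StrictMono (φ g)) :
    y ∈ orbitHull φ y := by
  rcases h.lt_or_gt with h | h
  · exact ⟨g, g⁻¹, h, by simpa using hmono g⁻¹ h⟩
  · exact ⟨g⁻¹, g, by simpa using hmono g⁻¹ h, h⟩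

theorem StrictMono.zpow_apply_ne {f : Equiv.Perm ℝ} (hf : StrictMono f) {y : ℝ} (hy : f y ≠ y)
    {m : ℤ} (hm : m ≠ 0) : (f ^ m) y ≠ y := by
  have hnat : ∀ n : ℕ, n ≠ 0 → (f ^ n) y ≠ y := by
    intro n hn
    rw [Equiv.Perm.coe_pow]
    rcases hy.lt_or_gt with h | h
    · exact (hf.strictAnti_iterate_of_map_lt h (Nat.pos_of_ne_zero hn)).ne
    · exact (hf.strictMono_iterate_of_lt_map h (Nat.pos_of_ne_zero hn)).ne'
  obtain ⟨n, rfl | rfl⟩ := m.eq_nat_or_neg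
  · rw [zpow_natCast]
    exact hnat n (by simpa using hm)
  · rw [zpow_neg, zpow_natCast]
    intro h
    exact hnat n (by simpa using hm) (Equiv.Perm.inv_eq_iff_eq.mp h).symm

/-- A normal subgroup of a group of increasing bijections of `ℝ` is trivial if its elements have
compact support avoiding the global fixed points and commuting elements are commensurable. -/
theorem normal_eq_bot_of_isCompact_support (hmono : ∀ g, StrictMono (φ g))
    (hinj : Function.Injective φ)
    (hcomm : ∀ a b : G, Commute a b → b ≠ 1 → ∃ m n : ℤ, m ≠ 0 ∧ a ^ m = b ^ n)
    (D : Subgroup G) [D.Normal] (hcpt : ∀ w ∈ D, IsCompact (closure {x | φ w x ≠ x}))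
    (hfix : ∀ w ∈ D, ∀ x ∈ closure {x | φ w x ≠ x}, ∃ g, φ g x ≠ x) : D = ⊥ := by
  have hfin : ∀ w ∈ D, (orbitHull φ '' {x | φ w x ≠ x}).Finite := by
    intro w hw
    obtain ⟨t, ht⟩ := (hcpt w hw).elim_finite_subcover (orbitHull φ) isOpen_orbitHull
      (fun x hx => mem_iUnion.mpr ⟨x, self_mem_orbitHull (hfix w hw x hx).choose_spec hmono⟩)
    refine (t.finite_toSet.image (orbitHull φ)).subset ?_
    rintro _ ⟨x, hx, rfl⟩
    obtain ⟨y, hy, hxy⟩ := mem_iUnion₂.mp (ht (subset_closure hx))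
    exact ⟨y, hy, (orbitHull_eq hxy hmono).symm⟩
  suffices key : ∀ n : ℕ, ∀ w ∈ D, (orbitHull φ '' {x | φ w x ≠ x}).ncard = n → w = 1 from
    (Subgroup.eq_bot_iff_forall D).mpr fun w hw => key _ w hw rfl
  intro n
  induction n using Nat.strong_induction_on with
  | _ n ih =>
  intro w hw hn
  by_contra hw1
  obtain ⟨y, hy⟩ : ∃ y, φ w y ≠ y := by
    by_contra! hall
    exact hw1 (hinj (by rw [map_one]; exact Equiv.ext hall))
  set J := closure {x | φ w x ≠ x} ∩ orbitHull φ y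
  have hyy : y ∈ orbitHull φ y := self_mem_orbitHull hy hmono
  have hyJ : y ∈ J := ⟨subset_closure hy, hyy⟩
  have hJc : IsCompact J := by
    refine (hcpt w hw).of_isClosed_subset ?_ inter_subset_left
    refine isClosed_of_closure_subset fun z hz => ?_
    have hzK : z ∈ closure {x | φ w x ≠ x} :=
      closure_minimal inter_subset_left isClosed_closure hz
    obtain ⟨g, hg⟩ := hfix w hw z hzK
    have hzz := self_mem_orbitHull hg hmono
    obtain ⟨x, hxz, -, hxy⟩ := mem_closure_iff.mp hz _ (isOpen_orbitHull z) hzz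
    refine ⟨hzK, ?_⟩
    rwa [← orbitHull_eq hxy hmono, orbitHull_eq hxz hmono]
  obtain ⟨a, haJ, ha⟩ := hJc.exists_isLeast ⟨y, hyJ⟩
  obtain ⟨b, hbJ, hb⟩ := hJc.exists_isGreatest ⟨y, hyJ⟩
  obtain ⟨-, v, -, hv⟩ : b ∈ orbitHull φ a := by
    rw [orbitHull_eq haJ.2 hmono]
    exact hbJ.2
  set w' := v * w * v⁻¹ with hw'
  have hw'D : w' ∈ D := Subgroup.Normal.conj_mem inferInstance w hw v
  have hdisj : ∀ x ∈ orbitHull φ y, φ w x = x ∨ φ w' x = x := by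
    intro x hx
    by_contra! hcon
    have h1 : x ≤ b := hb ⟨subset_closure hcon.1, hx⟩
    have h2 : a ≤ φ v⁻¹ x := by
      refine ha ⟨subset_closure fun h => hcon.2 ?_, apply_mem_orbitHull _ hx hmono⟩
      rw [hw', map_mul, map_mul, Equiv.Perm.mul_apply, Equiv.Perm.mul_apply, h,
        ← Equiv.Perm.mul_apply, ← map_mul, mul_inv_cancel, map_one, Equiv.Perm.one_apply]
    have h3 : φ v a ≤ x := by simpa using (hmono v).monotone h2
    exact absurd (hv.trans_le (h3.trans h1)) (lt_irrefl _)
  have hcommute : ∀ x ∈ orbitHull φ y, φ w (φ w' x) = φ w' (φ w x) := by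
    intro x hx
    rcases hdisj x hx with h | h
    · rcases hdisj (φ w' x) (apply_mem_orbitHull _ hx hmono) with h' | h'
      · rw [h', h]
      · rw [(φ w').injective h', h, (φ w').injective h']
    · rcases hdisj (φ w x) (apply_mem_orbitHull _ hx hmono) with h' | h'
      · rw [(φ w).injective h', h, (φ w).injective h']
      · rw [h', h]
  have htriv : ∀ x ∈ orbitHull φ y, φ ⁅w, w'⁆ x = x := by
    intro x hx
    have h := hcommute (φ (w' * w)⁻¹ x) (apply_mem_orbitHull _ hx hmono)
    rw [commutatorElement_def]
    simpa using h
  have hmoved : ∀ x, φ ⁅w, w'⁆ x ≠ x → orbitHull φ x ∈ orbitHull φ '' {x | φ w x ≠ x} := by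
    intro x hx
    have hxx := self_mem_orbitHull hx hmono
    by_contra hno
    have hall : ∀ g, φ w (φ g x) = φ g x := by
      intro g
      by_contra hg
      exact hno ⟨φ g x, hg, orbitHull_eq (apply_mem_orbitHull g hxx hmono) hmono⟩
    have hall' : ∀ g, φ w' (φ g x) = φ g x := by
      intro g
      have := hall (v⁻¹ * g)
      rw [map_mul, Equiv.Perm.mul_apply] at this
      rw [hw', map_mul, map_mul, Equiv.Perm.mul_apply, Equiv.Perm.mul_apply, this]
      simp
    apply hx
    have h3 := hall' 1
    have h4 := hall 1
    rw [map_one, Equiv.Perm.one_apply] at h3 h4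
    have h5 : φ (w' * w)⁻¹ x = x := by
      rw [map_inv, Equiv.Perm.inv_eq_iff_eq, map_mul, Equiv.Perm.mul_apply, h4, h3]
    have h6 : ⁅w, w'⁆ = w * w' * (w' * w)⁻¹ := by
      rw [commutatorElement_def]
      group
    rw [h6, map_mul, map_mul, Equiv.Perm.mul_apply, Equiv.Perm.mul_apply, h5, h3, h4]
  have hlt : (orbitHull φ '' {x | φ ⁅w, w'⁆ x ≠ x}).ncard < n := by
    rw [← hn]
    refine ncard_lt_ncard ⟨?_, fun hsub => ?_⟩ (hfin w hw)
    · rintro _ ⟨x, hx, rfl⟩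
      exact hmoved x hx
    · obtain ⟨x, hx, hxy⟩ := hsub ⟨y, hy, rfl⟩
      exact hx (htriv x (hxy ▸ self_mem_orbitHull hx hmono))
  have hcD : ⁅w, w'⁆ ∈ D := by
    rw [commutatorElement_def]
    exact D.mul_mem (D.mul_mem (D.mul_mem hw hw'D) (D.inv_mem hw)) (D.inv_mem hw'D)
  have hone := ih _ hlt _ hcD rfl
  have hw'1 : w' ≠ 1 := fun h => hw1 (by simpa [hw'] using h)
  obtain ⟨m, k, hm, hmk⟩ := hcomm w w' (commutatorElement_eq_one_iff_commute.mp hone) hw'1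
  have hfixed : φ w' y = y := (hdisj y hyy).resolve_left hy
  apply (hmono w).zpow_apply_ne hy hm
  rw [← map_zpow, hmk, map_zpow]
  exact Equiv.Perm.zpow_apply_eq_self_of_apply_eq_self hfixed k

end DisjointSupports

/-- Monod: H(ℝ) does not contain a nonabelian free subgroup: there is no
injective group homomorphism from the free group on two generators whose range consists of
elements of H(ℝ). -/
theorem no_free_subgroup_of_H :
    ¬ ∃ φ : FreeGroup Bool →* Equiv.Perm ℝ,
        Function.Injective φ ∧ ∀ w, MemH (φ w) := by
  rintro ⟨φ, hinj, hH⟩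
  have hmono : ∀ g, StrictMono (φ g) := fun g => (hH g).1
  have hcont : ∀ g, Continuous (φ g) := fun g =>
    (hmono g).monotone.continuous_of_surjective (φ g).surjective
  have htop : ∀ g, Tendsto (φ g) atTop atTop := fun g =>
    (hmono g).monotone.tendsto_atTop_atTop fun b => ⟨(φ g).symm b, by simp⟩
  have hbot : ∀ g, Tendsto (φ g) atBot atBot := fun g =>
    (hmono g).monotone.tendsto_atBot_atBot fun b => ⟨(φ g).symm b, by simp⟩
  refine FreeGroup.derivedSeries_two_ne_bot (normal_eq_bot_of_isCompact_support hmono hinj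
    (fun a b => IsFreeGroup.exists_zpow_eq_zpow_of_commute) _ ?_ ?_)
  · intro w hw
    have h1 : ∀ᶠ t in atTop, φ w t = t := by
      refine eventually_fixed_of_mem_derivedSeries_two Function.injective_id htop (fun g => ?_) hw
      obtain ⟨k, x, -, -, h, -⟩ := (hH g).2
      exact h.eventually_affine IsOrderBornology.atTop_le_cobounded (Ioi_mem_atTop _)
        ((htop g).mono_right IsOrderBornology.atTop_le_cobounded)
    have h2 : ∀ᶠ t in atBot, φ w t = t := by
      refine eventually_fixed_of_mem_derivedSeries_two Function.injective_id hbot (fun g => ?_) hw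
      obtain ⟨k, x, -, h, -, -⟩ := (hH g).2
      exact h.eventually_affine IsOrderBornology.atBot_le_cobounded (Iio_mem_atBot _)
        ((hbot g).mono_right IsOrderBornology.atBot_le_cobounded)
    obtain ⟨b, hb⟩ := eventually_atTop.mp h1
    obtain ⟨a, ha⟩ := eventually_atBot.mp h2
    refine isCompact_Icc.of_isClosed_subset isClosed_closure
      (closure_minimal (t := Icc a b) (fun x hx => ⟨?_, ?_⟩) isClosed_Icc)
    · exact le_of_not_ge fun h => hx (ha x h)
    · exact le_of_not_ge fun h => hx (hb x h)
  · intro w hw x hx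
    by_contra! hfix
    have hnhds : ∀ g, Tendsto (φ g) (𝓝 x) (𝓝 x) := fun g => by
      simpa only [hfix g] using (hcont g).tendsto x
    have hinv : Function.Injective fun t : ℝ => (t - x)⁻¹ :=
      inv_injective.comp sub_left_injective
    have hR : ∀ᶠ t in 𝓝[>] x, φ w t = t := by
      refine eventually_fixed_of_mem_derivedSeries_two hinv (fun g => ?_) (fun g => ?_) hw
      · refine (hnhds g).inf (tendsto_principal_principal.mpr fun t ht => ?_)
        simpa only [hfix g, mem_Ioi, mem_Iio] using hmono g ht
      · obtain ⟨s, hs, h⟩ := (hH g).2.isFracLinOn_right x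
        exact h.eventually_affine_inv (nhdsWithin_mono x fun t ht => ne_of_gt ht) hs
          ((hnhds g).mono_left nhdsWithin_le_nhds)
    have hLeft : ∀ᶠ t in 𝓝[<] x, φ w t = t := by
      refine eventually_fixed_of_mem_derivedSeries_two hinv (fun g => ?_) (fun g => ?_) hw
      · refine (hnhds g).inf (tendsto_principal_principal.mpr fun t ht => ?_)
        simpa only [hfix g, mem_Ioi, mem_Iio] using hmono g ht
      · obtain ⟨s, hs, h⟩ := (hH g).2.isFracLinOn_left x
        exact h.eventually_affine_inv (nhdsWithin_mono x fun t ht => ne_of_lt ht) hs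
          ((hnhds g).mono_left nhdsWithin_le_nhds)
    have hall : ∀ᶠ t in 𝓝 x, φ w t = t := by
      rw [← nhdsLT_sup_nhdsGE, eventually_sup, ← nhdsGT_sup_nhdsWithin_singleton, eventually_sup]
      exact ⟨hLeft, hR, by simp [hfix w]⟩
    exact (mem_closure_iff_frequently.mp hx) (hall.mono fun t ht => not_not.mpr ht)
end

section
/- Let F be the free group on two generators a and b, and let Γ_a be the set of elements of F whose reduced word begins with the letter a (with positive exponent) and ends with the letter a⁻¹. Then for every nonidentity element g of F, there exists h ∈ {1, a, a·b, a·b⁻¹} such that h·g·h⁻¹ ∈ Γ_a. -/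
namespace FreeGroup

/-- Conjugation by a word that cancels at neither end of the reduced word of `g`: the reduced word
of the conjugate starts with the first letter of the word and ends with the inverse letter. -/
theorem head?_getLast?_toWord_conj {α : Type*} [DecidableEq α] (c : α × Bool)
    (P : List (α × Bool)) (g : FreeGroup α)
    (h : IsReduced (c :: P ++ g.toWord ++ invRev (c :: P))) :
    (mk (c :: P) * g * (mk (c :: P))⁻¹).toWord.head? = some c ∧
      (mk (c :: P) * g * (mk (c :: P))⁻¹).toWord.getLast? = some (c.1, !c.2) := by
  have hword : (mk (c :: P) * g * (mk (c :: P))⁻¹).toWord =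
      c :: P ++ g.toWord ++ invRev (c :: P) := by
    conv_lhs => rw [← mk_toWord (x := g), inv_mk, mul_mk, mul_mk, toWord_mk]
    exact h.reduce_eq
  rw [hword]
  exact ⟨by simp, by rw [List.getLast?_append]; simp [invRev]⟩

/-- Conjugation by a reduced word `P` creates no cancellation when the last letter of `P` is neither
inverse to the first letter of `L` nor equal to the last letter of `L`. -/
theorem isReduced_append_append_invRev {α : Type*} {P L : List (α × Bool)} {p x y : α × Bool}
    (hP : IsReduced P) (hL : IsReduced L) (hp : P.getLast? = some p) (hx : L.head? = some x)
    (hy : L.getLast? = some y) (hpx : x ≠ (p.1, !p.2)) (hpy : y ≠ p) :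
    IsReduced (P ++ L ++ invRev P) := by
  have hinv : IsReduced (invRev P) := by
    rw [IsReduced, invRev, List.isChain_reverse, List.isChain_map]
    exact List.IsChain.imp (fun a b hab h => congrArg not (hab h.symm).symm) hP
  have hhead : (invRev P).head? = some (p.1, !p.2) := by simp [invRev, hp]
  obtain ⟨p, s⟩ := p
  obtain ⟨i, u⟩ := x
  obtain ⟨j, v⟩ := y
  refine List.isChain_append.2 ⟨List.isChain_append.2 ⟨hP, hL, ?_⟩, hinv, ?_⟩
  · rw [hp, hx]
    rintro _ ⟨⟩ _ ⟨⟩ rfl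
    cases s <;> cases u <;> simp_all
  · rw [List.getLast?_append, hy, hhead]
    rintro _ ⟨⟩ _ ⟨⟩ rfl
    cases s <;> cases v <;> simp_all

end FreeGroup

/-- In the free group F on two generators a = of 0 and b = of 1, for every
nonidentity element g there is h ∈ {1, a, a·b, a·b⁻¹} such that the reduced word of h·g·h⁻¹
begins with the letter a (positive exponent) and ends with the letter a⁻¹.  Here the reduced
word of an element is given by `FreeGroup.toWord`, a letter being a pair (generator, Bool)
with `true` for positive and `false` for negative exponent. -/
theorem conjugate_into_Gamma_a
    (g : FreeGroup (Fin 2)) (hg : g ≠ 1) :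
    ∃ h ∈ ({1, FreeGroup.of 0, FreeGroup.of 0 * FreeGroup.of 1,
        FreeGroup.of 0 * (FreeGroup.of 1)⁻¹} : Set (FreeGroup (Fin 2))),
      (h * g * h⁻¹).toWord.head? = some ((0 : Fin 2), true) ∧
      (h * g * h⁻¹).toWord.getLast? = some ((0 : Fin 2), false) := by
  have hne : g.toWord ≠ [] := by simpa using hg
  obtain ⟨x, hx⟩ : ∃ x, g.toWord.head? = some x := ⟨_, List.head?_eq_some_head hne⟩
  obtain ⟨y, hy⟩ : ∃ y, g.toWord.getLast? = some y := ⟨_, List.getLast?_eq_some_getLast hne⟩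
  have conj_b (s : Bool) (hxs : x ≠ (1, !s)) (hys : y ≠ (1, s)) :=
    FreeGroup.head?_getLast?_toWord_conj ((0 : Fin 2), true) [(1, s)] g
      (FreeGroup.isReduced_append_append_invRev (by simp [FreeGroup.IsReduced])
        FreeGroup.isReduced_toWord rfl hx hy hxs hys)
  by_cases ha : x ≠ (0, false) ∧ y ≠ (0, true)
  · exact ⟨FreeGroup.of 0, by simp, FreeGroup.head?_getLast?_toWord_conj (0, true) [] g
      (FreeGroup.isReduced_append_append_invRev (by simp)
        FreeGroup.isReduced_toWord rfl hx hy ha.1 ha.2)⟩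
  by_cases hb : x ≠ (1, false) ∧ y ≠ (1, true)
  · exact ⟨FreeGroup.of 0 * FreeGroup.of 1, by simp, conj_b true hb.1 hb.2⟩
  · exact ⟨FreeGroup.of 0 * (FreeGroup.of 1)⁻¹, by simp, conj_b false (by grind) (by grind)⟩
end
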